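/- The expected restocking cost of a route is nonnegative: for every route r = (v_0, v_{s_1},…,v_{s_l}, v_0), every i ∈ {0,…,l} and every q ∈ {0,…,Q}, the value function satisfies ν^r(i,q) ≥ Σ_{j=i}^{l−1} d(s_j, s_{j+1}) + d(s_l, 0). In particular, c_r = ν^r(0,Q) ≥ Σ_{j=0}^{l−1} d(s_j, s_{j+1}) + d(s_l, 0), i.e., the expected cost of a route under optimal restocking is at least its a priori cost; consequently, for any function γ : {0,…,N}×{0,…,N} → ℝ, the reduced cost φ(r) = c_r + γ(0,s_1) + Σ_{j=1}^{l−1} γ(s_j,s_{j+1}) + γ(s_l,0) satisfies φ(r) ≥ (d(0,s_1)+γ(0,s_1)) + Σ_{j=1}^{l−1}(d(s_j,s_{j+1})+γ(s_j,s_{j+1})) + (d(s_l,0)+γ(s_l,0)). -/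

import Mathlib

/-- `Ψ(k,q) = max(⌈(k−q)/Q⌉, 0)`: number of replenishment trips of capacity `Q`
needed to fulfill a demand of `k` with remaining quantity `q`. -/
noncomputable def psi (Q k q : ℕ) : ℤ :=
  max ⌈((k : ℚ) - (q : ℚ)) / (Q : ℚ)⌉ 0

/-- The value functions `ν^r(i,q)` of a route `r = (v_0, v_{s_1},…,v_{s_l}, v_0)`
(with `s 0 = 0`), computed by backward recursion on the fuel `l − i`:
`nuF Q d p s (l - i) i q = ν^r(i,q)`.  The base case (fuel `0`, i.e. `i = l`)
returns `d(s_l, 0)`; the recursive case takes the minimum of the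
direct-travel value `ν_dir` and the replenishment value `ν_rep`. -/
noncomputable def nuF (Q : ℕ) (d p : ℕ → ℕ → ℝ) (s : ℕ → ℕ) :
    ℕ → ℕ → ℕ → ℝ
  | 0, i, _ => d (s i) 0
  | j + 1, i, q =>
      min
        (d (s i) (s (i + 1)) + ∑' k : ℕ,
          ((d (s (i + 1)) 0 + d 0 (s (i + 1))) * (psi Q k q : ℝ)
            + nuF Q d p s j (i + 1)
                ((Q : ℤ) * psi Q k q + (q : ℤ) - (k : ℤ)).toNat) * p (s (i + 1)) k)
        (d (s i) 0 + d 0 (s (i + 1)) + ∑' k : ℕ,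
          ((d (s (i + 1)) 0 + d 0 (s (i + 1))) * (psi Q k Q : ℝ)
            + nuF Q d p s j (i + 1)
                ((Q : ℤ) * psi Q k Q + (Q : ℤ) - (k : ℤ)).toNat) * p (s (i + 1)) k)

theorem psi_nonneg (Q k q : ℕ) : 0 ≤ psi Q k q := le_max_right _ _

theorem psi_le {Q : ℕ} (hQ : 1 ≤ Q) (k q : ℕ) : psi Q k q ≤ k := by
  refine max_le (Int.ceil_le.2 ?_) (Int.natCast_nonneg k)
  have hQ' : (1 : ℚ) ≤ Q := by exact_mod_cast hQ
  have hk : (0 : ℚ) ≤ k := k.cast_nonneg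
  have hq : (0 : ℚ) ≤ q := q.cast_nonneg
  rw [div_le_iff₀ (by linarith)]
  push_cast
  nlinarith

/-- The mean of a function of at most linear growth, under a probability mass function with finite
mean, is at least any lower bound of the function. -/
theorem le_tsum_mul_of_linear_growth {w g : ℕ → ℝ} {a b c : ℝ} (hw : ∀ k, 0 ≤ w k)
    (hw1 : HasSum w 1) (hmean : Summable fun k : ℕ => (k : ℝ) * w k)
    (hlow : ∀ k, a ≤ g k) (hup : ∀ k, g k ≤ c * k + b) :
    a ≤ ∑' k, g k * w k := by
  have hsub : Summable fun k => (g k - a) * w k := by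
    refine Summable.of_nonneg_of_le (fun k => mul_nonneg (sub_nonneg.2 (hlow k)) (hw k))
      (fun k => ?_) ((hmean.mul_left c).add (hw1.summable.mul_left (b - a)))
    have := mul_le_mul_of_nonneg_right (hup k) (hw k)
    linarith
  have hconst : HasSum (fun k => a * w k) a := by simpa using hw1.mul_left a
  have hsum : Summable fun k => g k * w k := by
    refine (hsub.add hconst.summable).congr fun k => ?_
    ring
  exact hasSum_le (fun k => mul_le_mul_of_nonneg_right (hlow k) (hw k)) hconst hsum.hasSum

/-- The value functions are bounded above uniformly in the remaining quantity, because the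
replenishment value does not depend on it. -/
theorem exists_nuF_le (Q : ℕ) (d p : ℕ → ℕ → ℝ) (s : ℕ → ℕ) (n i : ℕ) :
    ∃ b, ∀ q, nuF Q d p s n i q ≤ b := by
  cases n with
  | zero => exact ⟨d (s i) 0, fun q => by rw [nuF]⟩
  | succ n => exact ⟨_, fun q => by rw [nuF]; exact min_le_right _ _⟩

/-- The value functions dominate the a priori cost of the remaining part of the route. -/
theorem sum_add_le_nuF {Q N : ℕ} (hQ : 1 ≤ Q)
    {d : ℕ → ℕ → ℝ} (hd0 : ∀ i j, i ≤ N → j ≤ N → 0 ≤ d i j)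
    (htri : ∀ i j k, i ≤ N → j ≤ N → k ≤ N → d i j ≤ d i k + d k j)
    {p : ℕ → ℕ → ℝ}
    (hp : ∀ m, 1 ≤ m → m ≤ N →
      (∀ k, 0 ≤ p m k) ∧ HasSum (p m) 1 ∧ Summable fun k : ℕ => (k : ℝ) * p m k)
    {l : ℕ} {s : ℕ → ℕ} (hs0 : s 0 = 0) (hs : ∀ j, 1 ≤ j → j ≤ l → 1 ≤ s j ∧ s j ≤ N)
    (n i q : ℕ) (hi : i + n = l) :
    (∑ j ∈ Finset.Ico i l, d (s j) (s (j + 1))) + d (s l) 0 ≤ nuF Q d p s n i q := by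
  induction n generalizing i q with
  | zero =>
    obtain rfl : i = l := by omega
    simp [nuF]
  | succ n ih =>
    have hsi : s i ≤ N := by
      rcases Nat.eq_zero_or_pos i with rfl | h
      · omega
      · exact (hs i h (by omega)).2
    obtain ⟨hpos, hsi'⟩ := hs (i + 1) (by omega) (by omega)
    obtain ⟨hw, hw1, hmean⟩ := hp _ hpos hsi'
    obtain ⟨b, hb⟩ := exists_nuF_le Q d p s n (i + 1)
    have hc : 0 ≤ d (s (i + 1)) 0 + d 0 (s (i + 1)) :=
      add_nonneg (hd0 _ _ hsi' N.zero_le) (hd0 _ _ N.zero_le hsi')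
    have hmain : ∀ r : ℕ, (∑ j ∈ Finset.Ico (i + 1) l, d (s j) (s (j + 1))) + d (s l) 0 ≤
        ∑' k : ℕ, ((d (s (i + 1)) 0 + d 0 (s (i + 1))) * (psi Q k r : ℝ)
            + nuF Q d p s n (i + 1)
                ((Q : ℤ) * psi Q k r + (r : ℤ) - (k : ℤ)).toNat) * p (s (i + 1)) k := by
      intro r
      refine le_tsum_mul_of_linear_growth (b := b) (c := d (s (i + 1)) 0 + d 0 (s (i + 1)))
        hw hw1 hmean (fun k => ?_) (fun k => add_le_add ?_ (hb _))
      · have hψ : (0 : ℝ) ≤ psi Q k r := by exact_mod_cast psi_nonneg Q k r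
        exact (ih _ _ (by omega)).trans (le_add_of_nonneg_left (mul_nonneg hc hψ))
      · have hψ : (psi Q k r : ℝ) ≤ k := by exact_mod_cast psi_le hQ k r
        exact mul_le_mul_of_nonneg_left hψ hc
    have htri' := htri _ _ 0 hsi hsi' N.zero_le
    rw [Finset.sum_eq_sum_Ico_succ_bot (by omega), nuF]
    refine le_min ?_ ?_
    · linarith [hmain q]
    · linarith [hmain Q]

/-- the expected restocking cost of a route is nonnegative: for
every route `r = (v_0, v_{s_1},…,v_{s_l}, v_0)`, every `i ∈ {0,…,l}` and
`q ∈ {0,…,Q}`, `ν^r(i,q) ≥ Σ_{j=i}^{l−1} d(s_j,s_{j+1}) + d(s_l,0)`; in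
particular `c_r = ν^r(0,Q)` is at least the a priori cost of `r`, and the
reduced cost `φ(r) = c_r + Σ γ`-terms is at least the corresponding sum of
`d + γ` over the arcs of `r`. -/
theorem stmt9 (Q N : ℕ) (hQ : 1 ≤ Q)
    (d : ℕ → ℕ → ℝ) (hd0 : ∀ i j, i ≤ N → j ≤ N → 0 ≤ d i j)
    (htri : ∀ i j k, i ≤ N → j ≤ N → k ≤ N → d i j ≤ d i k + d k j)
    (p : ℕ → ℕ → ℝ)
    (hp : ∀ m, 1 ≤ m → m ≤ N →
      (∀ k, 0 ≤ p m k) ∧ HasSum (p m) 1 ∧ Summable fun k : ℕ => (k : ℝ) * p m k)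
    (l : ℕ) (hl : 1 ≤ l) (s : ℕ → ℕ) (hs0 : s 0 = 0)
    (hs : ∀ j, 1 ≤ j → j ≤ l → 1 ≤ s j ∧ s j ≤ N)
    (γ : ℕ → ℕ → ℝ) :
    (∀ i q, i ≤ l → q ≤ Q →
      (∑ j ∈ Finset.Ico i l, d (s j) (s (j + 1))) + d (s l) 0 ≤
        nuF Q d p s (l - i) i q) ∧
    ((∑ j ∈ Finset.range l, d (s j) (s (j + 1))) + d (s l) 0 ≤ nuF Q d p s l 0 Q) ∧
    ((∑ j ∈ Finset.range l, (d (s j) (s (j + 1)) + γ (s j) (s (j + 1))))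
        + (d (s l) 0 + γ (s l) 0) ≤
      nuF Q d p s l 0 Q + (∑ j ∈ Finset.range l, γ (s j) (s (j + 1))) + γ (s l) 0) := by
  have hcost : (∑ j ∈ Finset.range l, d (s j) (s (j + 1))) + d (s l) 0 ≤ nuF Q d p s l 0 Q := by
    rw [Finset.range_eq_Ico]
    exact sum_add_le_nuF hQ hd0 htri hp hs0 hs l 0 Q (Nat.zero_add l)
  refine ⟨fun i q hi _ => sum_add_le_nuF hQ hd0 htri hp hs0 hs (l - i) i q (by omega), hcost, ?_⟩
  rw [Finset.sum_add_distrib]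
  linarith
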